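/- arXiv:1502.02842 — 2 statements merged into one kernel-verified Lean document; each statement's English description precedes it below -/
import Mathlib

section
/- Let n ≥ 2 and t ≥ 1, and let A ∈ CS+^{nt} be indexed by V × [t] where V is a set of size n. If Σ_{i,j∈[t]} A_{ui,vj} = 1 for all u,v ∈ V, then A lies in the boundary of CS+^{nt}, i.e., A does not belong to the interior of CS+^{nt} taken within the space S^{nt} of real symmetric nt×nt matrices. -/
open Matrix

/-- The completely positive semidefinite cone, for matrices indexed by a finite type. -/
def IsCSPlus {ι : Type} [Fintype ι] (A : Matrix ι ι ℝ) : Prop :=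
  ∃ d : ℕ, 1 ≤ d ∧ ∃ X : ι → Matrix (Fin d) (Fin d) ℝ,
    (∀ i, (X i).PosSemidef) ∧ ∀ i j, A i j = (X i * X j).trace

/-- Completely positive semidefinite matrices have nonnegative quadratic form. -/
lemma IsCSPlus.dotProduct_mulVec_nonneg {ι : Type} [Fintype ι] {A : Matrix ι ι ℝ}
    (hA : IsCSPlus A) (x : ι → ℝ) : 0 ≤ x ⬝ᵥ A *ᵥ x := by
  obtain ⟨d, -, X, hX, hAX⟩ := hA
  have hM : (∑ i, x i • X i)ᴴ = ∑ i, x i • X i := by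
    simp only [conjTranspose_sum, conjTranspose_smul, star_trivial, (hX _).isHermitian.eq]
  have hquad : x ⬝ᵥ A *ᵥ x = ((∑ i, x i • X i)ᴴ * ∑ i, x i • X i).trace := by
    rw [hM, Finset.sum_mul_sum, trace_sum]
    simp only [dotProduct, mulVec, Finset.mul_sum, trace_sum, smul_mul_smul_comm, trace_smul,
      smul_eq_mul, hAX]
    exact Finset.sum_congr rfl fun i _ => Finset.sum_congr rfl fun j _ => by ring
  rw [hquad]
  exact (posSemidef_conjTranspose_mul_self _).trace_nonneg

/-- A symmetric matrix with a nonzero isotropic vector is not interior to the completely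
positive semidefinite cone. -/
lemma notMem_interior_isCSPlus_of_dotProduct_mulVec_eq_zero {ι : Type} [Fintype ι]
    {A : Matrix ι ι ℝ} (hsym : A.IsSymm) {x : ι → ℝ} (hx : x ≠ 0) (hAx : x ⬝ᵥ A *ᵥ x = 0) :
    (⟨A, hsym⟩ : {B : Matrix ι ι ℝ // B.IsSymm}) ∉
      interior {B : {B : Matrix ι ι ℝ // B.IsSymm} | IsCSPlus B.val} := by
  intro hmem
  have hsymm (ε : ℝ) : (A - ε • vecMulVec x x).IsSymm :=
    hsym.sub (IsSymm.smul (transpose_vecMulVec x x) ε)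
  let f : ℝ → {B : Matrix ι ι ℝ // B.IsSymm} := fun ε => ⟨A - ε • vecMulVec x x, hsymm ε⟩
  have hf : Continuous f := by
    refine Continuous.subtype_mk ?_ _
    fun_prop
  have hf0 : f 0 = ⟨A, hsym⟩ := by simp [f]
  rw [mem_interior_iff_mem_nhds, ← hf0] at hmem
  obtain ⟨δ, hδ, hball⟩ := Metric.mem_nhds_iff.mp (hf.continuousAt.preimage_mem_nhds hmem)
  have hcs : IsCSPlus (A - (δ / 2) • vecMulVec x x) :=
    hball (by simp [abs_of_pos hδ, hδ] : δ / 2 ∈ Metric.ball (0 : ℝ) δ)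
  have hnonneg := hcs.dotProduct_mulVec_nonneg x
  rw [sub_mulVec, dotProduct_sub, hAx, smul_mulVec, vecMulVec_mulVec] at hnonneg
  have hpos : 0 < x ⬝ᵥ x :=
    (dotProduct_self_star_nonneg x).lt_of_ne' (by simpa using hx)
  simp only [dotProduct_smul, smul_eq_mul, op_smul_eq_smul] at hnonneg
  nlinarith [mul_pos (half_pos hδ) (mul_pos hpos hpos)]

/-- If `A ∈ CS+^{nt}` (indexed by `V × [t]`, `|V| = n`) satisfies
`Σ_{i,j∈[t]} A_{ui,vj} = 1` for all `u,v ∈ V`, then `A` lies in the boundary of `CS+^{nt}`,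
i.e. it is not in the interior of `CS+^{nt}` taken within the space of symmetric matrices. -/
theorem stmt10 {V : Type} [Fintype V] (n t : ℕ) (hn : 2 ≤ n) (ht : 1 ≤ t)
    (hV : Fintype.card V = n)
    (A : Matrix (V × Fin t) (V × Fin t) ℝ) (hA : IsCSPlus A) (hsym : A.IsSymm)
    (hsum : ∀ u v : V, (∑ i : Fin t, ∑ j : Fin t, A (u, i) (v, j)) = 1) :
    (⟨A, hsym⟩ : {B : Matrix (V × Fin t) (V × Fin t) ℝ // B.IsSymm}) ∉
      interior {B : {B : Matrix (V × Fin t) (V × Fin t) ℝ // B.IsSymm} | IsCSPlus B.val} := by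
  classical
  obtain ⟨u, v, huv⟩ := Fintype.exists_pair_of_one_lt_card (hV ▸ hn : 1 < Fintype.card V)
  let y : V → ℝ := Pi.single u 1 - Pi.single v 1
  have hy : ∑ w, y w = 0 := by simp [y]
  refine notMem_interior_isCSPlus_of_dotProduct_mulVec_eq_zero hsym (x := fun p => y p.1) ?_ ?_
  · intro h
    have := congrFun h (u, ⟨0, ht⟩)
    simp [y, huv] at this
  · calc (fun p : V × Fin t => y p.1) ⬝ᵥ A *ᵥ (fun p => y p.1)
        = ∑ w, ∑ w', y w * y w' * ∑ i, ∑ j, A (w, i) (w', j) := by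
          simp only [dotProduct, mulVec, Fintype.sum_prod_type, Finset.mul_sum]
          refine Finset.sum_congr rfl fun w _ => ?_
          rw [Finset.sum_comm]
          refine Finset.sum_congr rfl fun w' _ => Finset.sum_congr rfl fun i _ =>
            Finset.sum_congr rfl fun j _ => by ring
      _ = (∑ w, y w) * ∑ w', y w' := by simp only [hsum, mul_one, Finset.sum_mul_sum]
      _ = 0 := by rw [hy, zero_mul]
end

section
/- For every finite simple graph G there exists k_0 ∈ ℕ such that λ_k(G) = χ̃_q(G) for all k ≥ k_0. -/
open Matrix

/-- The linear functional `L_{G,t}`: the sum of the off-diagonal color entries on each vertex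
plus, for each (unordered) edge `uv`, the sum `Σ_i A_{ui,vi}` (written as half the sum over
ordered adjacent pairs). -/
noncomputable def LG {V : Type} [Fintype V] (G : SimpleGraph V) [DecidableRel G.Adj] (t : ℕ)
    (A : Matrix (V × Fin t) (V × Fin t) ℝ) : ℝ :=
  (∑ u : V, ∑ i : Fin t, ∑ j : Fin t, if i ≠ j then A (u, i) (u, j) else 0) +
    (1 / 2) * ∑ u : V, ∑ v : V,
      if G.Adj u v then ∑ i : Fin t, A (u, i) (v, i) else 0

/-- Feasibility of `t` in the program defining `χ̃_q(G)`: there is a symmetric matrix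
`A ∈ cl(CS+^{nt})` lying in the affine space `A^t` with `L_{G,t}(A) = 0`. -/
def chiqFeas {V : Type} [Fintype V] (G : SimpleGraph V) [DecidableRel G.Adj] (t : ℕ) : Prop :=
  ∃ A : Matrix (V × Fin t) (V × Fin t) ℝ, A.IsSymm ∧
    A ∈ closure {B : Matrix (V × Fin t) (V × Fin t) ℝ | IsCSPlus B} ∧
    (∀ u v : V, (∑ i : Fin t, ∑ j : Fin t, A (u, i) (v, j)) = 1) ∧
    LG G t A = 0

/-- The parameter `χ̃_q(G)`. -/
noncomputable def chiqTilde {V : Type} [Fintype V] (G : SimpleGraph V)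
    [DecidableRel G.Adj] : ℕ :=
  sInf {t : ℕ | chiqFeas G t}

/-- Feasibility of `t` in the program defining `λ_k(G)`: a symmetric `A ∈ cl(CS+^{nt})`
in the relaxed affine space `A^t_k` with `L_{G,t}(A) ≤ 1/k`. -/
def lamFeas {V : Type} [Fintype V] (G : SimpleGraph V) [DecidableRel G.Adj]
    (k t : ℕ) : Prop :=
  ∃ A : Matrix (V × Fin t) (V × Fin t) ℝ, A.IsSymm ∧
    A ∈ closure {B : Matrix (V × Fin t) (V × Fin t) ℝ | IsCSPlus B} ∧
    (∀ u v : V, |(∑ i : Fin t, ∑ j : Fin t, A (u, i) (v, j)) - 1| ≤ 1 / (k : ℝ)) ∧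
    LG G t A ≤ 1 / (k : ℝ)

/-- The parameter `λ_k(G)`. -/
noncomputable def lam {V : Type} [Fintype V] (G : SimpleGraph V) [DecidableRel G.Adj]
    (k : ℕ) : ℕ :=
  sInf {t : ℕ | lamFeas G k t}

open scoped MatrixOrder in
/-- The trace of a product of two real positive semidefinite matrices is nonnegative. -/
theorem trace_mul_nonneg_of_posSemidef {n : Type*} [Fintype n] {X Y : Matrix n n ℝ}
    (hX : X.PosSemidef) (hY : Y.PosSemidef) : 0 ≤ (X * Y).trace := by
  classical
  obtain ⟨B, rfl⟩ := CStarAlgebra.nonneg_iff_eq_star_mul_self.mp hY.nonneg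
  rw [Matrix.star_eq_conjTranspose, ← Matrix.mul_assoc, Matrix.trace_mul_comm, ← Matrix.mul_assoc]
  exact (hX.mul_mul_conjTranspose_same B).trace_nonneg

/-- Matrices in the closure of the completely positive semidefinite cone are entrywise
nonnegative. -/
theorem nonneg_of_mem_closure_isCSPlus {ι : Type} [Fintype ι] {A : Matrix ι ι ℝ}
    (hA : A ∈ closure {B : Matrix ι ι ℝ | IsCSPlus B}) (i j : ι) : 0 ≤ A i j := by
  have hclosed : IsClosed {B : Matrix ι ι ℝ | 0 ≤ B i j} :=
    isClosed_le continuous_const (continuous_id.matrix_elem i j)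
  refine closure_minimal ?_ hclosed hA
  rintro B ⟨d, -, X, hX, hB⟩
  simpa only [Set.mem_ofPred_eq, hB] using trace_mul_nonneg_of_posSemidef (hX i) (hX j)

section

variable {V : Type} [Fintype V] (G : SimpleGraph V) [DecidableRel G.Adj]

/-- The feasible region of the program defining `λ_k(G)`. -/
def lamRegion (k t : ℕ) : Set (Matrix (V × Fin t) (V × Fin t) ℝ) :=
  {A | A.IsSymm ∧ A ∈ closure {B : Matrix (V × Fin t) (V × Fin t) ℝ | IsCSPlus B} ∧
    (∀ u v : V, |(∑ i : Fin t, ∑ j : Fin t, A (u, i) (v, j)) - 1| ≤ 1 / (k : ℝ)) ∧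
    LG G t A ≤ 1 / (k : ℝ)}

theorem continuous_LG (t : ℕ) : Continuous (LG G t) := by
  unfold LG
  refine Continuous.add ?_ (continuous_const.mul ?_)
  · refine continuous_finsetSum _ fun u _ => continuous_finsetSum _ fun i _ =>
      continuous_finsetSum _ fun j _ => ?_
    split_ifs
    · exact continuous_id.matrix_elem _ _
    · exact continuous_const
  · refine continuous_finsetSum _ fun u _ => continuous_finsetSum _ fun v _ => ?_
    split_ifs
    · exact continuous_finsetSum _ fun i _ => continuous_id.matrix_elem _ _
    · exact continuous_const

theorem LG_nonneg {t : ℕ} {A : Matrix (V × Fin t) (V × Fin t) ℝ} (hA : ∀ p q, 0 ≤ A p q) :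
    0 ≤ LG G t A := by
  unfold LG
  refine add_nonneg ?_ (mul_nonneg (by norm_num) ?_)
  · refine Finset.sum_nonneg fun u _ => Finset.sum_nonneg fun i _ =>
      Finset.sum_nonneg fun j _ => ?_
    split_ifs
    · exact hA _ _
    · exact le_rfl
  · refine Finset.sum_nonneg fun u _ => Finset.sum_nonneg fun v _ => ?_
    split_ifs
    · exact Finset.sum_nonneg fun i _ => hA _ _
    · exact le_rfl

theorem isClosed_lamRegion (k t : ℕ) : IsClosed (lamRegion G k t) := by
  have hsymm : IsClosed {A : Matrix (V × Fin t) (V × Fin t) ℝ | A.IsSymm} :=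
    isClosed_eq continuous_id.matrix_transpose continuous_id
  have hsum : IsClosed {A : Matrix (V × Fin t) (V × Fin t) ℝ |
      ∀ u v : V, |(∑ i : Fin t, ∑ j : Fin t, A (u, i) (v, j)) - 1| ≤ 1 / (k : ℝ)} := by
    simp only [Set.ofPred_forall]
    refine isClosed_iInter fun u => isClosed_iInter fun v => isClosed_le ?_ continuous_const
    refine ((continuous_finsetSum _ fun i _ => continuous_finsetSum _ fun j _ =>
      continuous_id.matrix_elem _ _).sub continuous_const).abs
  exact hsymm.inter (isClosed_closure.inter
    (hsum.inter (isClosed_le (continuous_LG G t) continuous_const)))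

theorem lamRegion_subset {k l : ℕ} (hk : 0 < k) (hkl : k ≤ l) (t : ℕ) :
    lamRegion G l t ⊆ lamRegion G k t := by
  have h : 1 / (l : ℝ) ≤ 1 / (k : ℝ) :=
    one_div_le_one_div_of_le (by exact_mod_cast hk) (by exact_mod_cast hkl)
  rintro A ⟨hsymm, hcl, hsum, hL⟩
  exact ⟨hsymm, hcl, fun u v => (hsum u v).trans h, hL.trans h⟩

theorem isCompact_lamRegion_one (t : ℕ) : IsCompact (lamRegion G 1 t) := by
  have hbox : IsCompact (Set.univ.pi fun _ : V × Fin t =>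
      Set.univ.pi fun _ : V × Fin t => Set.Icc (0 : ℝ) 2) :=
    isCompact_univ_pi fun _ => isCompact_univ_pi fun _ => isCompact_Icc
  refine hbox.of_isClosed_subset (isClosed_lamRegion G 1 t) ?_
  rintro A ⟨-, hcl, hsum, -⟩ ⟨u, i⟩ - ⟨v, j⟩ -
  have hA := nonneg_of_mem_closure_isCSPlus hcl
  refine ⟨hA _ _, ?_⟩
  have hj : A (u, i) (v, j) ≤ ∑ j : Fin t, A (u, i) (v, j) :=
    Finset.single_le_sum (f := fun j => A (u, i) (v, j)) (fun j _ => hA _ _)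
      (Finset.mem_univ j)
  have hi : ∑ j : Fin t, A (u, i) (v, j) ≤ ∑ i : Fin t, ∑ j : Fin t, A (u, i) (v, j) :=
    Finset.single_le_sum (f := fun i => ∑ j : Fin t, A (u, i) (v, j))
      (fun i _ => Finset.sum_nonneg fun j _ => hA _ _) (Finset.mem_univ i)
  have habs := (abs_le.mp (hsum u v)).2
  norm_num at habs
  linarith

theorem lamFeas_of_chiqFeas {t : ℕ} (h : chiqFeas G t) (k : ℕ) : lamFeas G k t := by
  obtain ⟨A, hsymm, hcl, hsum, hL⟩ := h
  have hk : 0 ≤ 1 / (k : ℝ) := by positivity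
  exact ⟨A, hsymm, hcl, fun u v => by simp [hsum u v], hL.trans_le hk⟩

/-- If `t` is feasible for every relaxation, then it is feasible for the limit program. -/
theorem chiqFeas_of_forall_lamFeas {t : ℕ} (h : ∀ k, lamFeas G (k + 1) t) : chiqFeas G t := by
  obtain ⟨A, hA⟩ := IsCompact.nonempty_iInter_of_sequence_nonempty_isCompact_isClosed
    (fun k => lamRegion G (k + 1) t)
    (fun k => lamRegion_subset G k.succ_pos (k + 1).le_succ t) h
    (isCompact_lamRegion_one G t) (fun k => isClosed_lamRegion G (k + 1) t)
  rw [Set.mem_iInter] at hA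
  have hlim : Filter.Tendsto (fun k : ℕ => 1 / ((k + 1 : ℕ) : ℝ)) Filter.atTop (nhds 0) := by
    simpa using tendsto_one_div_add_atTop_nhds_zero_nat (𝕜 := ℝ)
  obtain ⟨hsymm, hcl, -, -⟩ := hA 0
  refine ⟨A, hsymm, hcl, fun u v => ?_, le_antisymm ?_ ?_⟩
  · have hle : |(∑ i : Fin t, ∑ j : Fin t, A (u, i) (v, j)) - 1| ≤ 0 :=
      ge_of_tendsto' hlim fun k => (hA k).2.2.1 u v
    exact sub_eq_zero.mp (abs_nonpos_iff.mp hle)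
  · exact ge_of_tendsto' hlim fun k => (hA k).2.2.2
  · exact LG_nonneg G (nonneg_of_mem_closure_isCSPlus hcl)

/-- A proper coloring yields a feasible point of the program defining `χ̃_q(G)`. -/
theorem chiqFeas_of_coloring {t : ℕ} (c : G.Coloring (Fin t)) : chiqFeas G t := by
  refine ⟨Matrix.of fun p q => (if c p.1 = p.2 then 1 else 0) * (if c q.1 = q.2 then 1 else 0),
    ?_, subset_closure ⟨1, le_rfl,
      fun p => Matrix.diagonal fun _ => if c p.1 = p.2 then 1 else 0, ?_, ?_⟩, ?_, ?_⟩
  · ext p q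
    simp only [Matrix.transpose_apply, Matrix.of_apply, mul_comm]
  · intro p
    refine Matrix.PosSemidef.diagonal fun _ => ?_
    dsimp only [Pi.zero_apply]
    split_ifs <;> norm_num
  · intro p q
    simp [Matrix.diagonal_mul_diagonal, Matrix.trace_diagonal]
  · intro u v
    simp
  · have hoff (u : V) (i j : Fin t) : (if i ≠ j then
        (if c u = i then (1 : ℝ) else 0) * (if c u = j then 1 else 0) else 0) = 0 := by
      grind
    have hedge (u v : V) : (if G.Adj u v then ∑ i : Fin t,
        (if c u = i then (1 : ℝ) else 0) * (if c v = i then 1 else 0) else 0) = 0 := by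
      split_ifs with huv
      · have := c.valid huv
        exact Finset.sum_eq_zero fun i _ => by grind
      · rfl
    simp only [LG, Matrix.of_apply, hoff, hedge, Finset.sum_const_zero, mul_zero, add_zero]

theorem exists_chiqFeas : ∃ t, chiqFeas G t :=
  ⟨Fintype.card V, chiqFeas_of_coloring G <|
    (SimpleGraph.Coloring.mk (Fintype.equivFin V) fun h =>
      (Fintype.equivFin V).injective.ne h.ne)⟩

theorem exists_forall_not_lamFeas {t : ℕ} (h : ¬ chiqFeas G t) :
    ∃ k₀, ∀ k, k₀ ≤ k → ¬ lamFeas G k t := by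
  obtain ⟨k, hk⟩ := not_forall.mp (mt (chiqFeas_of_forall_lamFeas G) h)
  refine ⟨k + 1, fun l hl hfeas => hk ?_⟩
  exact Set.Nonempty.mono (lamRegion_subset G k.succ_pos hl t) hfeas

end

/-- For every finite (simple) graph `G` there is `k₀` with `λ_k(G) = χ̃_q(G)` for all `k ≥ k₀`. -/
theorem stmt12 {V : Type} [Fintype V] (G : SimpleGraph V) [DecidableRel G.Adj]
    (hV : 1 ≤ Fintype.card V) :
    ∃ k₀ : ℕ, ∀ k : ℕ, k₀ ≤ k → lam G k = chiqTilde G := by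
  have hT : chiqFeas G (chiqTilde G) := Nat.sInf_mem (exists_chiqFeas G)
  have hlt : ∀ t, t < chiqTilde G → ∃ k₀, ∀ k, k₀ ≤ k → ¬ lamFeas G k t := fun t ht =>
    exists_forall_not_lamFeas G (Nat.notMem_of_lt_sInf ht)
  choose! K hK using hlt
  refine ⟨(Finset.range (chiqTilde G)).sup K, fun k hk => ?_⟩
  have hmem : lamFeas G k (chiqTilde G) := lamFeas_of_chiqFeas G hT k
  refine le_antisymm (Nat.sInf_le hmem) (not_lt.mp fun hlam => ?_)
  have hKk : K (lam G k) ≤ k := (Finset.le_sup (Finset.mem_range.mpr hlam)).trans hk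
  have hne : {t : ℕ | lamFeas G k t}.Nonempty := ⟨_, hmem⟩
  exact hK _ hlam k hKk (Nat.sInf_mem hne)
end
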